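/- Let n ≥ 8 be an even integer. In the saturation game (n, PM), where PM is the property of admitting a perfect matching, Max has a strategy (regardless of whether he moves first or second) guaranteeing that the graph at the end of the game has at least C(n−4,2) edges; in particular s(n, PM) ≥ C(n−4,2). -/

import Mathlib

open SimpleGraph

/-- The graph obtained from `G` by adding the edge `e`. -/
def addEdge {V : Type*} (G : SimpleGraph V) (e : Sym2 V) : SimpleGraph V :=
  G ⊔ SimpleGraph.fromEdgeSet {e}

/-- In the saturation game for the monotone property `P`, a move `e` is legal in
position `G` if `e` is a non-loop non-edge of `G` whose addition keeps `P` unsatisfied. -/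
def legalMove {V : Type*} (P : SimpleGraph V → Prop) (G : SimpleGraph V) (e : Sym2 V) : Prop :=
  ¬ e.IsDiag ∧ e ∉ G.edgeSet ∧ ¬ P (addEdge G e)

/-- `GameEnsures P Q turn G` : in the saturation game for the property `P`, played from
position `G` where the protagonist is to move iff `turn = true`, the protagonist has a
strategy guaranteeing that the final (`P`-saturated) graph satisfies `Q`. -/
inductive GameEnsures {V : Type*} (P Q : SimpleGraph V → Prop) : Bool → SimpleGraph V → Prop
  | gameOver (turn : Bool) (G : SimpleGraph V)
      (hend : ∀ e, ¬ legalMove P G e) (hQ : Q G) : GameEnsures P Q turn G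
  | protagonistMove (G : SimpleGraph V) (e : Sym2 V) (hl : legalMove P G e)
      (h : GameEnsures P Q false (addEdge G e)) : GameEnsures P Q true G
  | opponentMove (G : SimpleGraph V) (e₀ : Sym2 V) (hl : legalMove P G e₀)
      (h : ∀ e, legalMove P G e → GameEnsures P Q true (addEdge G e)) :
      GameEnsures P Q false G

/-- The property of admitting a perfect matching. -/
def hasPerfectMatching {V : Type*} (G : SimpleGraph V) : Prop :=
  ∃ M : G.Subgraph, M.IsPerfectMatching

/-- `MatchableOn G S`: the vertices of `S` can be perfectly matched among themselves in `G`. -/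
def MatchableOn {V : Type*} (G : SimpleGraph V) (S : Finset V) : Prop :=
  ∃ f : V → V, ∀ v ∈ S, f v ∈ S ∧ f (f v) = v ∧ G.Adj v (f v)

/-- Deleting any vertex of `D` leaves a matchable set. -/
def FactorCriticalOn {V : Type*} [DecidableEq V] (G : SimpleGraph V) (D : Finset V) : Prop :=
  ∀ v ∈ D, MatchableOn G (D.erase v)

/-- `D` is matchable, and every `w ∈ D` has a partner `w' ∈ D` such that attaching a new vertex to
both `w` and `w'` produces a factor-critical set. -/
def EarReadyOn {V : Type*} [DecidableEq V] (G : SimpleGraph V) (D : Finset V) : Prop :=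
  MatchableOn G D ∧ ∀ w ∈ D, ∃ w' ∈ D, w' ≠ w ∧ ∀ v ∈ D,
    (v ≠ w ∧ MatchableOn G ((D.erase v).erase w)) ∨
      (v ≠ w' ∧ MatchableOn G ((D.erase v).erase w'))

section Matchings

variable {V : Type*} {G H : SimpleGraph V} {S T D : Finset V}

theorem addEdge_adj {a b x y : V} :
    (addEdge G s(a, b)).Adj x y ↔
      G.Adj x y ∨ (x ≠ y ∧ (x = a ∧ y = b ∨ x = b ∧ y = a)) := by
  simp only [addEdge, SimpleGraph.sup_adj, SimpleGraph.fromEdgeSet_adj, Set.mem_singleton_iff,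
    Sym2.eq_iff]
  tauto

theorem le_addEdge (G : SimpleGraph V) (e : Sym2 V) : G ≤ addEdge G e := le_sup_left

theorem addEdge_eq_self {a b : V} (h : G.Adj a b) : addEdge G s(a, b) = G := by
  ext x y
  rw [addEdge_adj]
  constructor
  · rintro (h' | ⟨-, ⟨rfl, rfl⟩ | ⟨rfl, rfl⟩⟩)
    exacts [h', h, h.symm]
  · exact Or.inl

theorem MatchableOn.mono (h : MatchableOn G S) (hGH : G ≤ H) : MatchableOn H S := by
  obtain ⟨f, hf⟩ := h
  exact ⟨f, fun v hv => ⟨(hf v hv).1, (hf v hv).2.1, hGH (hf v hv).2.2⟩⟩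

theorem matchableOn_empty : MatchableOn G ∅ := ⟨id, by simp⟩

theorem hasPerfectMatching_iff_exists :
    hasPerfectMatching G ↔ ∃ f : V → V, ∀ v, f (f v) = v ∧ G.Adj v (f v) := by
  constructor
  · rintro ⟨M, hM⟩
    rw [SimpleGraph.Subgraph.isPerfectMatching_iff] at hM
    choose f hf hu using hM
    exact ⟨f, fun v => ⟨(hu (f v) v (hf v).symm).symm, (hf v).adj_sub⟩⟩
  · rintro ⟨f, hf⟩
    refine ⟨⟨Set.univ, fun a b => b = f a, ?_, by simp, ⟨?_⟩⟩, ?_⟩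
    · rintro a b rfl
      exact (hf a).2
    · rintro a b rfl
      exact (hf a).1.symm
    · rw [SimpleGraph.Subgraph.isPerfectMatching_iff]
      intro v
      exact ⟨f v, rfl, fun y hy => hy⟩

theorem MatchableOn.hasPerfectMatching (h : MatchableOn G S) (hS : ∀ v, v ∈ S) :
    hasPerfectMatching G := by
  obtain ⟨f, hf⟩ := h
  exact hasPerfectMatching_iff_exists.2 ⟨f, fun v => (hf v (hS v)).2⟩

theorem not_hasPerfectMatching_of_isolated {x : V} (hx : ∀ y, ¬ G.Adj x y) :
    ¬ hasPerfectMatching G := by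
  rw [hasPerfectMatching_iff_exists]
  rintro ⟨f, hf⟩
  exact hx _ (hf x).2

theorem isChain_adj_mono {l : List V} (hle : G ≤ H)
    (h : l.IsChain G.Adj) : l.IsChain H.Adj :=
  h.imp fun _ _ hab => hle hab

variable [DecidableEq V]

theorem MatchableOn.union (hS : MatchableOn G S) (hT : MatchableOn G T) (hST : Disjoint S T) :
    MatchableOn G (S ∪ T) := by
  obtain ⟨f, hf⟩ := hS
  obtain ⟨g, hg⟩ := hT
  rw [Finset.disjoint_left] at hST
  refine ⟨fun v => if v ∈ S then f v else g v, fun v hv => ?_⟩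
  by_cases h : v ∈ S
  · have := hf v h
    simp [h, this]
  · have hv' : v ∈ T := by simpa [h] using hv
    have := hg v hv'
    have h2 : g v ∉ S := fun h3 => hST h3 this.1
    simp [h, h2, this]

theorem matchableOn_pair {a b : V} (h : G.Adj a b) : MatchableOn G {a, b} := by
  refine ⟨fun v => if v = a then b else a, fun v hv => ?_⟩
  have := h.ne
  have := h.symm
  grind

/-- Adjoining an edge to a matchable set. -/
theorem MatchableOn.adjoin {a b : V} (hS : MatchableOn G S) (h : G.Adj a b) (ha : a ∉ S)
    (hb : b ∉ S) (hT : ∀ v, v ∈ T ↔ v = a ∨ v = b ∨ v ∈ S) : MatchableOn G T := by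
  have hT' : T = {a, b} ∪ S := by
    ext v
    simp [hT]
  rw [hT']
  exact (matchableOn_pair h).union hS (by simp [ha, hb])

theorem MatchableOn.insert_insert {a b : V} (hS : MatchableOn G S) (h : G.Adj a b) (ha : a ∉ S)
    (hb : b ∉ S) : MatchableOn G (insert a (insert b S)) :=
  hS.adjoin h ha hb (by simp)

omit [DecidableEq V] in
theorem matchableOn_congr (h : MatchableOn G S) (hT : ∀ v, v ∈ T ↔ v ∈ S) : MatchableOn G T := by
  rwa [Finset.ext hT]

theorem FactorCriticalOn.mono (h : FactorCriticalOn G D) (hGH : G ≤ H) : FactorCriticalOn H D :=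
  fun v hv => (h v hv).mono hGH

theorem EarReadyOn.mono (h : EarReadyOn G D) (hGH : G ≤ H) : EarReadyOn H D := by
  refine ⟨h.1.mono hGH, fun w hw => ?_⟩
  obtain ⟨w', hw', hne, hv⟩ := h.2 w hw
  exact ⟨w', hw', hne, fun v hvD => (hv v hvD).imp (fun h => ⟨h.1, h.2.mono hGH⟩)
    (fun h => ⟨h.1, h.2.mono hGH⟩)⟩

theorem FactorCriticalOn.matchableOn_insert {x d : V} (h : FactorCriticalOn G D) (hd : d ∈ D)
    (hx : x ∉ D) (hxd : G.Adj x d) : MatchableOn G (insert x D) :=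
  (h d hd).adjoin hxd (by simp [hx]) (by simp) (by grind)

theorem FactorCriticalOn.earReadyOn_insert {x d : V} (h : FactorCriticalOn G D) (hd : d ∈ D)
    (hx : x ∉ D) (hxd : G.Adj x d) : EarReadyOn G (insert x D) := by
  refine ⟨h.matchableOn_insert hd hx hxd, fun w hw => ?_⟩
  have key : ∀ v ∈ D, MatchableOn G (((insert x D).erase v).erase x) := fun v hv =>
    matchableOn_congr (h v hv) (by grind)
  have key' : ∀ v ∈ D, MatchableOn G (((insert x D).erase x).erase v) := fun v hv =>
    matchableOn_congr (h v hv) (by grind)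
  by_cases hwx : w = x
  · subst hwx
    refine ⟨d, by simp [hd], by grind, fun v hv => ?_⟩
    by_cases hvx : v = w
    · subst hvx
      exact Or.inr ⟨by grind, key' d hd⟩
    · exact Or.inl ⟨hvx, key v (by grind)⟩
  · have hwD : w ∈ D := by grind
    refine ⟨x, by simp, Ne.symm hwx, fun v hv => ?_⟩
    by_cases hvx : v = x
    · subst hvx
      exact Or.inl ⟨Ne.symm hwx, key' w hwD⟩
    · exact Or.inr ⟨hvx, key v (by grind)⟩

/-- Attaching a new vertex to both ends `w`, `w'` of an admissible pair. -/
theorem factorCriticalOn_insert {x w w' : V} (hD : MatchableOn G D)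
    (h : ∀ v ∈ D, (v ≠ w ∧ MatchableOn G ((D.erase v).erase w)) ∨
      (v ≠ w' ∧ MatchableOn G ((D.erase v).erase w')))
    (hw : w ∈ D) (hw' : w' ∈ D) (hx : x ∉ D) (hxw : G.Adj x w) (hxw' : G.Adj x w') :
    FactorCriticalOn G (insert x D) := by
  intro v hv
  by_cases hvx : v = x
  · exact matchableOn_congr hD (by grind)
  · rcases h v (by grind) with ⟨hne, hm⟩ | ⟨hne, hm⟩
    · exact hm.adjoin hxw (by grind) (by grind) (by grind)
    · exact hm.adjoin hxw' (by grind) (by grind) (by grind)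

/-- Attaching a path `u v` to both ends `w`, `w'` of an admissible pair. -/
theorem EarReadyOn.insert_path {u v w w' : V} (hD : EarReadyOn G D)
    (h : ∀ z ∈ D, (z ≠ w ∧ MatchableOn G ((D.erase z).erase w)) ∨
      (z ≠ w' ∧ MatchableOn G ((D.erase z).erase w')))
    (hw : w ∈ D) (hw' : w' ∈ D) (hu : u ∉ D) (hv : v ∉ D) (huv : G.Adj u v)
    (huw : G.Adj u w) (hvw' : G.Adj v w') :
    EarReadyOn G (insert u (insert v D)) := by
  have hne := huv.ne
  refine ⟨hD.1.adjoin huv hu hv (by grind), fun y hy => ?_⟩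
  have e1 : MatchableOn G (((insert u (insert v D)).erase u).erase v) :=
    matchableOn_congr hD.1 (by grind)
  have e2 : MatchableOn G (((insert u (insert v D)).erase v).erase u) :=
    matchableOn_congr hD.1 (by grind)
  have e3 : ∀ z ∈ D, MatchableOn G (((insert u (insert v D)).erase z).erase u) ∨
      MatchableOn G (((insert u (insert v D)).erase z).erase v) := by
    intro z hz
    rcases h z hz with ⟨hzw, hm⟩ | ⟨hzw, hm⟩
    · exact Or.inr (hm.adjoin huw (by grind) (by grind) (by grind))
    · exact Or.inl (hm.adjoin hvw' (by grind) (by grind) (by grind))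
  by_cases hyu : y = u
  · subst hyu
    refine ⟨v, by simp, hne.symm, fun z hz => ?_⟩
    have := e3 z
    grind
  by_cases hyv : y = v
  · subst hyv
    refine ⟨u, by simp, hne, fun z hz => ?_⟩
    have := e3 z
    grind
  have hyD : y ∈ D := by grind
  obtain ⟨y', hy', hne', hp⟩ := hD.2 y hyD
  refine ⟨y', by simp [hy'], hne', fun z hz => ?_⟩
  by_cases hzu : z = u
  · subst hzu
    rcases hp w' hw' with ⟨hzw, hm⟩ | ⟨hzw, hm⟩
    · exact Or.inl ⟨Ne.symm hyu, hm.adjoin hvw' (by grind) (by grind) (by grind)⟩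
    · exact Or.inr ⟨by grind, hm.adjoin hvw' (by grind) (by grind) (by grind)⟩
  by_cases hzv : z = v
  · subst hzv
    rcases hp w hw with ⟨hzw, hm⟩ | ⟨hzw, hm⟩
    · exact Or.inl ⟨Ne.symm hyv, hm.adjoin huw (by grind) (by grind) (by grind)⟩
    · exact Or.inr ⟨by grind, hm.adjoin huw (by grind) (by grind) (by grind)⟩
  rcases hp z (by grind) with ⟨hzw, hm⟩ | ⟨hzw, hm⟩
  · exact Or.inl ⟨hzw, hm.adjoin huv (by grind) (by grind) (by grind)⟩
  · exact Or.inr ⟨hzw, hm.adjoin huv (by grind) (by grind) (by grind)⟩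

/-- Attaching a triangle by two disjoint edges to both ends `w`, `w'` of an admissible pair. -/
theorem factorCriticalOn_insert_triangle {a b c w w' : V} (hD : MatchableOn G D)
    (h : ∀ v ∈ D, (v ≠ w ∧ MatchableOn G ((D.erase v).erase w)) ∨
      (v ≠ w' ∧ MatchableOn G ((D.erase v).erase w')))
    (hw : w ∈ D) (hw' : w' ∈ D) (ha : a ∉ D) (hb : b ∉ D) (hc : c ∉ D)
    (hab : G.Adj a b) (hac : G.Adj a c) (hbc : G.Adj b c)
    (haw : G.Adj a w) (hbw' : G.Adj b w') :
    FactorCriticalOn G (insert a (insert b (insert c D))) := by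
  have h1 := hab.ne
  have h2 := hac.ne
  have h3 := hbc.ne
  intro v hv
  by_cases hva : v = a
  · exact hD.adjoin hbc hb hc (by grind)
  by_cases hvb : v = b
  · exact hD.adjoin hac ha hc (by grind)
  by_cases hvc : v = c
  · exact hD.adjoin hab ha hb (by grind)
  rcases h v (by grind) with ⟨hne, hm⟩ | ⟨hne, hm⟩
  · have hm' : MatchableOn G (insert b (insert c ((D.erase v).erase w))) :=
      hm.adjoin hbc (by grind) (by grind) (by grind)
    exact hm'.adjoin haw (by grind) (by grind) (by grind)
  · have hm' : MatchableOn G (insert a (insert c ((D.erase v).erase w'))) :=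
      hm.adjoin hac (by grind) (by grind) (by grind)
    exact hm'.adjoin hbw' (by grind) (by grind) (by grind)

theorem matchableOn_toFinset :
    ∀ {l : List V}, l.Nodup → l.IsChain G.Adj → Even l.length → MatchableOn G l.toFinset
  | [], _, _, _ => matchableOn_empty
  | [_], _, _, h => by simp at h
  | a :: b :: l, hnd, hc, h => by
    rw [List.isChain_cons_cons] at hc
    have hnd' := hnd
    simp only [List.nodup_cons, List.mem_cons, not_or] at hnd'
    have := matchableOn_toFinset (l := l) hnd'.2.2 hc.2.tail
      (by simpa [Nat.even_add_one, parity_simps] using h)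
    exact this.adjoin hc.1 (by simp [hnd']) (by simp [hnd']) (by simp)

theorem factorCriticalOn_of_cycle {l : List V} (hnd : l.Nodup) (hc : l.IsChain G.Adj)
    (hcl : ∀ x ∈ l.getLast?, ∀ y ∈ l.head?, G.Adj x y) (hodd : Odd l.length) :
    FactorCriticalOn G l.toFinset := by
  intro v hv
  obtain ⟨s, t, rfl⟩ := List.append_of_mem (List.mem_toFinset.1 hv)
  have hts : MatchableOn G (t ++ s).toFinset := by
    refine matchableOn_toFinset ?_ ?_ ?_
    · grind
    · rw [List.isChain_append] at hc ⊢
      refine ⟨hc.2.1.tail, hc.1, fun x hx y hy => hcl x ?_ y ?_⟩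
      · cases t <;> simp_all
      · cases s <;> simp_all
    · simp only [List.length_append, List.length_cons] at hodd ⊢
      grind
  exact matchableOn_congr hts (by
    clear hc hcl hts
    simp only [List.nodup_middle, List.nodup_cons, List.mem_append] at hnd
    simp
    grind)

theorem earReadyOn_of_cycle {l : List V} (hnd : l.Nodup) (hc : l.IsChain G.Adj)
    (hcl : ∀ x ∈ l.getLast?, ∀ y ∈ l.head?, G.Adj x y) (heven : Even l.length) :
    EarReadyOn G l.toFinset := by
  refine ⟨matchableOn_toFinset hnd hc heven, fun w hw => ?_⟩
  obtain ⟨s, t, rfl⟩ := List.append_of_mem (List.mem_toFinset.1 hw)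
  have hchain : (w :: (t ++ s)).IsChain G.Adj := by
    rw [← List.cons_append]
    rw [List.isChain_append] at hc ⊢
    refine ⟨hc.2.1, hc.1, fun x hx y hy => hcl x ?_ y ?_⟩
    · simp_all
    · cases s <;> simp_all
  have hlast : ∀ x ∈ (t ++ s).getLast?, G.Adj x w := by
    intro x hx
    rw [List.isChain_append] at hc
    rcases List.eq_nil_or_concat s with rfl | ⟨s', y, rfl⟩
    · simp only [List.append_nil] at hx
      refine hcl x ?_ w (by simp)
      cases t <;> simp_all
    · have : x = y := by simpa using hx.symm
      subst this
      exact hc.2.2 x (by simp) w (by simp)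
  obtain ⟨r, hr⟩ : ∃ r, t ++ s = r := ⟨_, rfl⟩
  have hnd' : (w :: r).Nodup := by grind
  have hlen : Odd r.length := by grind
  have hset : (s ++ w :: t).toFinset = (w :: r).toFinset := by
    ext
    grind [List.mem_toFinset]
  rw [hset]
  rw [hr] at hchain hlast
  clear hset hr hc hcl heven hw hnd
  obtain _ | ⟨w', r⟩ := r
  · simp at hlen
  have hwr := hchain.tail
  have hrest : MatchableOn G r.toFinset :=
    matchableOn_toFinset (by grind) hwr.tail (by grind)
  refine ⟨w', by simp, by grind, fun v hv => ?_⟩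
  by_cases hvw : v = w
  · exact Or.inr ⟨by grind, matchableOn_congr hrest (by grind [List.mem_toFinset])⟩
  by_cases hvw' : v = w'
  · exact Or.inl ⟨by grind, matchableOn_congr hrest (by grind [List.mem_toFinset])⟩
  obtain ⟨p, q, rfl⟩ := List.append_of_mem (show v ∈ r by grind [List.mem_toFinset])
  have hpq := hwr.tail
  simp only [List.tail_cons] at hwr hpq
  rw [List.isChain_append] at hpq
  rcases Nat.even_or_odd p.length with hp | hp
  · refine Or.inr ⟨hvw', ?_⟩
    have h1 : MatchableOn G p.toFinset := matchableOn_toFinset (by grind) hpq.1 hp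
    have h2 : MatchableOn G (q ++ [w]).toFinset := by
      refine matchableOn_toFinset (by grind) ?_ (by grind)
      rw [List.isChain_append]
      refine ⟨hpq.2.1.tail, by simp, fun x hx y hy => ?_⟩
      have : y = w := by simpa using hy.symm
      subst this
      refine hlast x ?_
      have : q ≠ [] := by grind
      simp_all [List.getLast?_cons, List.getLast?_append]
    simp only [List.nodup_cons, List.nodup_middle, List.mem_cons, List.mem_append] at hnd'
    clear hlast hchain hwr hrest hpq
    refine matchableOn_congr (h1.union h2 ?_) ?_
    · rw [Finset.disjoint_left]
      grind [List.mem_toFinset, List.nodup_append]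
    · grind [List.mem_toFinset]
  · refine Or.inl ⟨hvw, ?_⟩
    have h1 : MatchableOn G (w' :: p).toFinset := by
      refine matchableOn_toFinset (by grind) ?_ (by grind)
      rw [← List.cons_append, List.isChain_append] at hwr
      exact hwr.1
    have h2 : MatchableOn G q.toFinset :=
      matchableOn_toFinset (by grind) hpq.2.1.tail (by grind)
    simp only [List.nodup_cons, List.nodup_middle, List.mem_cons, List.mem_append] at hnd'
    clear hlast hchain hwr hrest hpq
    refine matchableOn_congr (h1.union h2 ?_) ?_
    · rw [Finset.disjoint_left]
      grind [List.mem_toFinset, List.nodup_append]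
    · grind [List.mem_toFinset]

end Matchings

section Game

variable {V : Type*} [Fintype V] {G : SimpleGraph V} {D : Finset V}

omit [Fintype V] in
theorem legalMove_mk {P : SimpleGraph V → Prop} {a b : V} :
    legalMove P G s(a, b) ↔ a ≠ b ∧ ¬ G.Adj a b ∧ ¬ P (addEdge G s(a, b)) := by
  simp [legalMove]

theorem ncard_compl_edgeSet_addEdge_lt {P : SimpleGraph V → Prop} {e : Sym2 V}
    (h : legalMove P G e) : (addEdge G e).edgeSetᶜ.ncard < G.edgeSetᶜ.ncard := by
  refine Set.ncard_lt_ncard ?_ (Set.toFinite _)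
  rw [Set.ssubset_iff_of_subset
    (Set.compl_subset_compl.2 (SimpleGraph.edgeSet_mono (le_addEdge G e)))]
  exact ⟨e, h.2.1, by simp [addEdge, h.1]⟩

theorem gameEnsures_of_forall_ge {P Q : SimpleGraph V → Prop} {G : SimpleGraph V}
    (hQ : ∀ H, G ≤ H → Q H) (turn : Bool) : GameEnsures P Q turn G := by
  induction hm : G.edgeSetᶜ.ncard using Nat.strong_induction_on generalizing G turn with
  | _ m ih =>
    subst hm
    by_cases hend : ∀ e, ¬ legalMove P G e
    · exact .gameOver turn G hend (hQ G le_rfl)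
    · push Not at hend
      obtain ⟨e₀, he₀⟩ := hend
      have step : ∀ e, legalMove P G e → ∀ t, GameEnsures P Q t (addEdge G e) := fun e he t =>
        ih _ (ncard_compl_edgeSet_addEdge_lt he) (fun H hH => hQ H ((le_addEdge G e).trans hH)) t rfl
      cases turn
      · exact .opponentMove G e₀ he₀ fun e he => step e he true
      · exact .protagonistMove G e₀ he₀ (step e₀ he₀ false)

/-- Max can guarantee at least `C(n-4, 2)` edges in the perfect matching game from position `G`. -/
def MaxEnsures (turn : Bool) (G : SimpleGraph V) : Prop :=
  GameEnsures hasPerfectMatching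
    (fun G : SimpleGraph V => (Fintype.card V - 4).choose 2 ≤ G.edgeSet.ncard) turn G

theorem choose_le_ncard_edgeSet [DecidableEq V] (hD : Fintype.card V ≤ D.card + 4)
    (hcl : ∀ a ∈ D, ∀ b ∈ D, a ≠ b → G.Adj a b) :
    (Fintype.card V - 4).choose 2 ≤ G.edgeSet.ncard := by
  calc (Fintype.card V - 4).choose 2 ≤ D.card.choose 2 := Nat.choose_le_choose 2 (by omega)
    _ = (D.offDiag.image Sym2.mk.uncurry).card := (Sym2.card_image_offDiag D).symm
    _ = ((D.offDiag.image Sym2.mk.uncurry : Finset (Sym2 V)) : Set (Sym2 V)).ncard :=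
        (Set.ncard_coe_finset _).symm
    _ ≤ G.edgeSet.ncard := by
        refine Set.ncard_le_ncard ?_ (Set.toFinite _)
        intro e he
        simp only [Finset.coe_image, Set.mem_image, Finset.mem_coe, Finset.mem_offDiag] at he
        obtain ⟨⟨a, b⟩, ⟨ha, hb, hab⟩, rfl⟩ := he
        exact hcl a ha b hb hab

theorem maxEnsures_true_of_add {a b : V} (hab : a ≠ b)
    (hPM : ¬ hasPerfectMatching (addEdge G s(a, b)))
    (h : ∀ turn, MaxEnsures turn (addEdge G s(a, b))) : MaxEnsures true G := by
  by_cases hG : G.Adj a b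
  · rw [addEdge_eq_self hG] at h
    exact h true
  · exact .protagonistMove G s(a, b) (legalMove_mk.2 ⟨hab, hG, hPM⟩) (h false)

/-- If a property `I` of positions is not affected by edges inside `D`, and Max can answer every
move leaving `D`, then Max wins: he waits inside `D` until `D` becomes a clique. -/
theorem maxEnsures_of_filling [DecidableEq V] (hD : Fintype.card V ≤ D.card + 4)
    (I : SimpleGraph V → Prop)
    (hPM : ∀ G, I G → ¬ hasPerfectMatching G)
    (hI : ∀ G, I G → ∀ a ∈ D, ∀ b ∈ D, a ≠ b → I (addEdge G s(a, b)))
    (hout : ∀ G, I G → ∀ a b, a ∉ D → a ≠ b → ¬ G.Adj a b →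
      ¬ hasPerfectMatching (addEdge G s(a, b)) →
      I (addEdge G s(a, b)) ∨ MaxEnsures true (addEdge G s(a, b)))
    {G : SimpleGraph V} (hG : I G) (turn : Bool) : MaxEnsures turn G := by
  induction hm : G.edgeSetᶜ.ncard using Nat.strong_induction_on generalizing G turn with
  | _ m ih =>
    subst hm
    by_cases hcl : ∀ a ∈ D, ∀ b ∈ D, a ≠ b → G.Adj a b
    · exact gameEnsures_of_forall_ge (fun H hH => choose_le_ncard_edgeSet hD
        fun a ha b hb hab => hH (hcl a ha b hb hab)) turn
    · push Not at hcl
      obtain ⟨a, ha, b, hb, hab, hnadj⟩ := hcl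
      have hIab := hI G hG a ha b hb hab
      have hleg : legalMove hasPerfectMatching G s(a, b) :=
        legalMove_mk.2 ⟨hab, hnadj, hPM _ hIab⟩
      cases turn
      · refine .opponentMove G _ hleg fun e he => ?_
        induction e with | _ c d
        have hlt := ncard_compl_edgeSet_addEdge_lt he
        have he' := legalMove_mk.1 he
        by_cases hc : c ∈ D
        · by_cases hd : d ∈ D
          · exact ih _ hlt (hI G hG c hc d hd he'.1) true rfl
          · rw [Sym2.eq_swap] at he' hlt ⊢
            rcases hout G hG d c hd he'.1.symm (fun h => he'.2.1 h.symm) he'.2.2 with h | h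
            · exact ih _ hlt h true rfl
            · exact h
        · rcases hout G hG c d hc he'.1 he'.2.1 he'.2.2 with h | h
          · exact ih _ hlt h true rfl
          · exact h
      · exact .protagonistMove G _ hleg (ih _ (ncard_compl_edgeSet_addEdge_lt hleg) hIab false rfl)

variable [DecidableEq V]

theorem maxEnsures_of_factorCritical_isolated {x : V} (hD : Fintype.card V ≤ D.card + 4)
    (hcov : ∀ z, z ∈ D ∨ z = x) (hx : x ∉ D) (hfc : FactorCriticalOn G D)
    (hiso : ∀ y, ¬ G.Adj x y) (turn : Bool) : MaxEnsures turn G := by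
  refine maxEnsures_of_filling hD (fun G => FactorCriticalOn G D ∧ ∀ y, ¬ G.Adj x y)
    (fun G h => not_hasPerfectMatching_of_isolated h.2) ?_ ?_ ⟨hfc, hiso⟩ turn
  · rintro G ⟨hfc, hiso⟩ a ha b hb hab
    refine ⟨hfc.mono (le_addEdge _ _), fun y => ?_⟩
    rw [addEdge_adj]
    grind
  · rintro G ⟨hfc, hiso⟩ a b ha hab - hPM
    obtain rfl : a = x := by grind
    refine absurd (MatchableOn.hasPerfectMatching (S := insert a D) ?_ (by grind)) hPM
    exact (hfc.mono (le_addEdge _ _)).matchableOn_insert (d := b) (by grind) ha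
      (addEdge_adj.2 (by grind))

/-- The three distinct vertices outside `D` are `u`, `v`, `w`. -/
def IsComplTriple (D : Finset V) (u v w : V) : Prop :=
  (∀ z, z ∈ D ∨ z = u ∨ z = v ∨ z = w) ∧
    u ∉ D ∧ v ∉ D ∧ w ∉ D ∧ u ≠ v ∧ u ≠ w ∧ v ≠ w

/-- The four distinct vertices outside `D` are `u`, `v`, `x`, `y`. -/
def IsComplQuad (D : Finset V) (u v x y : V) : Prop :=
  (∀ z, z ∈ D ∨ z = u ∨ z = v ∨ z = x ∨ z = y) ∧ u ∉ D ∧ v ∉ D ∧ x ∉ D ∧ y ∉ D ∧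
    u ≠ v ∧ u ≠ x ∧ u ≠ y ∧ v ≠ x ∧ v ≠ y ∧ x ≠ y

theorem maxEnsures_of_factorCritical_edge {u v w : V} (hD : Fintype.card V ≤ D.card + 4)
    (hc : IsComplTriple D u v w) (hfc : FactorCriticalOn G D) (huv : G.Adj u v)
    (hPM : ¬ hasPerfectMatching G) (turn : Bool) : MaxEnsures turn G := by
  obtain ⟨hcov, hu, hv, hw, huv', huw', hvw'⟩ := hc
  refine maxEnsures_of_filling hD
    (fun G => FactorCriticalOn G D ∧ G.Adj u v ∧ ¬ hasPerfectMatching G)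
    (fun G h => h.2.2) ?_ ?_ ⟨hfc, huv, hPM⟩ turn
  · rintro G ⟨hfc, huv, hPM⟩ a ha b hb hab
    refine ⟨hfc.mono (le_addEdge _ _), le_addEdge _ _ huv, fun h => hPM ?_⟩
    obtain ⟨f, hf⟩ := hasPerfectMatching_iff_exists.1 h
    have hout : ∀ z, z ∉ D → G.Adj z (f z) := by
      intro z hz
      have := addEdge_adj.1 (hf z).2
      grind
    have key : ∀ p q r, p ∉ D → q ∉ D → r ∉ D → p ≠ q → p ≠ r →
        (∀ z, z ∈ D ∨ z = p ∨ z = q ∨ z = r) → f p ∈ D → G.Adj q r → hasPerfectMatching G := by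
      intro p q r hp hq hr hpq hpr hcov hfp hqr
      have := hqr.ne
      exact ((hfc.matchableOn_insert hfp hp (hout p hp)).insert_insert hqr (by grind)
        (by grind)).hasPerfectMatching (by grind)
    have hne : ∀ z, f z ≠ z := fun z => (hf z).2.ne'
    have hinv := fun z => (hf z).1
    have h1 := hout u hu
    have h2 := hout v hv
    have h3 := hout w hw
    rcases hcov (f w) with h | h | h | h
    · exact key w u v hw hu hv (by grind) (by grind) (by grind) h huv
    · exact key v u w hv hu hw (by grind) (by grind) (by grind) (by grind) (h ▸ h3.symm)
    · exact key u v w hu hv hw (by grind) (by grind) (by grind) (by grind) (h ▸ h3.symm)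
    · exact absurd h (hne w)
  · rintro G ⟨hfc, huv, -⟩ a b - - - hPM
    exact Or.inl ⟨hfc.mono (le_addEdge _ _), le_addEdge _ _ huv, hPM⟩

theorem maxEnsures_of_earReady_two {x y : V} (hD : Fintype.card V ≤ D.card + 4)
    (hcov : ∀ z, z ∈ D ∨ z = x ∨ z = y) (hx : x ∉ D) (hy : y ∉ D) (hxy : x ≠ y)
    (her : EarReadyOn G D) (hin : ∀ a b, G.Adj a b → a ∈ D) (turn : Bool) :
    MaxEnsures turn G := by
  refine maxEnsures_of_filling hD (fun G => EarReadyOn G D ∧ ∀ a b, G.Adj a b → a ∈ D)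
    (fun G h => not_hasPerfectMatching_of_isolated (x := x) fun z hz => hx (h.2 _ _ hz))
    ?_ ?_ ⟨her, hin⟩ turn
  · rintro G ⟨her, hin⟩ a ha b hb hab
    refine ⟨her.mono (le_addEdge _ _), fun c d => ?_⟩
    rw [addEdge_adj]
    grind
  · rintro G ⟨her, hin⟩ a b ha hab hnadj hPM
    right
    obtain ⟨c, hc, hca, hcov'⟩ : ∃ c, c ∉ D ∧ c ≠ a ∧ ∀ z, z ∈ D ∨ z = a ∨ z = c := by
      rcases hcov a with h | rfl | rfl
      · exact absurd h ha
      · exact ⟨y, hy, hxy.symm, hcov⟩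
      · exact ⟨x, hx, hxy, by grind⟩
    by_cases hb : b ∈ D
    · obtain ⟨b', hb', hbb', hv⟩ := her.2 b hb
      have hle : G ≤ addEdge (addEdge G s(a, b)) s(a, b') :=
        (le_addEdge _ _).trans (le_addEdge _ _)
      have hiso : ∀ z, ¬ (addEdge (addEdge G s(a, b)) s(a, b')).Adj c z := by
        intro z
        rw [addEdge_adj, addEdge_adj]
        grind
      refine maxEnsures_true_of_add (a := a) (b := b') (by grind)
        (not_hasPerfectMatching_of_isolated hiso) fun turn => ?_
      refine maxEnsures_of_factorCritical_isolated (D := insert a D) (x := c) ?_ (by grind)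
        (by grind) ?_ hiso turn
      · rw [Finset.card_insert_of_notMem ha]
        omega
      · refine factorCriticalOn_insert (w := b) (w' := b') (her.1.mono hle)
          (fun v hvD => ?_) hb hb' ha (addEdge_adj.2 ?_) (addEdge_adj.2 ?_)
        · exact (hv v hvD).imp (fun h => ⟨h.1, h.2.mono hle⟩) (fun h => ⟨h.1, h.2.mono hle⟩)
        · exact Or.inl (addEdge_adj.2 (by grind))
        · grind
    · obtain rfl : b = c := by grind
      exact absurd (((her.1.mono (le_addEdge _ _)).insert_insert (addEdge_adj.2 (by grind)) ha
        hc).hasPerfectMatching (by grind)) hPM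

theorem maxEnsures_of_factorCritical_three {u v w : V} (hD : Fintype.card V ≤ D.card + 4)
    (hc : IsComplTriple D u v w) (hfc : FactorCriticalOn G D)
    (hin : ∀ a b, G.Adj a b → a ∈ D) (turn : Bool) :
    MaxEnsures turn G := by
  refine maxEnsures_of_filling hD (fun G => FactorCriticalOn G D ∧ ∀ a b, G.Adj a b → a ∈ D)
    (fun G h => not_hasPerfectMatching_of_isolated (x := u) fun z hz => hc.2.1 (h.2 _ _ hz))
    ?_ ?_ ⟨hfc, hin⟩ turn
  · rintro G ⟨hfc, hin⟩ a ha b hb hab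
    refine ⟨hfc.mono (le_addEdge _ _), fun c d => ?_⟩
    rw [addEdge_adj]
    grind
  · rintro G ⟨hfc, hin⟩ a b ha hab hnadj hPM
    right
    obtain ⟨c, d, hacd⟩ : ∃ c d, IsComplTriple D a c d := by
      unfold IsComplTriple at *
      obtain ⟨hcov, hu, hv, hw, huv, huw, hvw⟩ := hc
      rcases hcov a with h | rfl | rfl | rfl
      · exact absurd h ha
      · exact ⟨v, w, by grind⟩
      · exact ⟨u, w, by grind⟩
      · exact ⟨u, v, by grind⟩
    by_cases hb : b ∈ D
    · have had : (addEdge G s(a, b)).Adj a b := addEdge_adj.2 (by grind)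
      obtain ⟨hcov, -, hcD, hdD, hac, had', hcd⟩ := hacd
      refine maxEnsures_of_earReady_two (D := insert a D) (x := c) (y := d) ?_ (by grind)
        (by grind) (by grind) hcd
        ((hfc.mono (le_addEdge _ _)).earReadyOn_insert hb ha had) (fun z t => ?_) true
      · rw [Finset.card_insert_of_notMem ha]
        omega
      · rw [addEdge_adj]
        grind
    · have had : (addEdge G s(a, b)).Adj a b := addEdge_adj.2 (by grind)
      obtain ⟨t, ht⟩ : ∃ t, IsComplTriple D a b t := by
        unfold IsComplTriple at *
        by_cases hbc : b = c
        · exact ⟨d, by grind⟩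
        · exact ⟨c, by grind⟩
      exact maxEnsures_of_factorCritical_edge hD ht (hfc.mono (le_addEdge _ _)) had hPM true

omit [Fintype V] [DecidableEq V] in
theorem not_hasPerfectMatching_of_triple {a b c : V}
    (hin : ∀ z t, G.Adj z t → (z = a ∨ z = b ∨ z = c) → t = a ∨ t = b ∨ t = c)
    (hab : a ≠ b) (hac : a ≠ c) (hbc : b ≠ c) : ¬ hasPerfectMatching G := by
  rw [hasPerfectMatching_iff_exists]
  rintro ⟨f, hf⟩
  have ha := hin a _ (hf a).2 (by simp)
  have hb := hin b _ (hf b).2 (by simp)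
  have hc := hin c _ (hf c).2 (by simp)
  have ha' := (hf a).2.ne
  have hb' := (hf b).2.ne
  have hc' := (hf c).2.ne
  have hinv := fun z => (hf z).1
  grind

theorem maxEnsures_of_earReady_triangle {a b c y : V} (hD : Fintype.card V ≤ D.card + 4)
    (hc : IsComplQuad D a b c y) (her : EarReadyOn G D)
    (htri : ∀ z t, z ∉ D → t ∉ D → z ≠ y → t ≠ y → z ≠ t → G.Adj z t)
    (hin : ∀ z t, G.Adj z t → (z ∈ D ∧ t ∈ D) ∨ (z ∉ D ∧ t ∉ D ∧ z ≠ y)) (turn : Bool) :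
    MaxEnsures turn G := by
  have hy : y ∉ D := hc.2.2.2.2.1
  refine maxEnsures_of_filling hD
    (fun G => EarReadyOn G D ∧ (∀ z t, z ∉ D → t ∉ D → z ≠ y → t ≠ y → z ≠ t → G.Adj z t) ∧
      ∀ z t, G.Adj z t → (z ∈ D ∧ t ∈ D) ∨ (z ∉ D ∧ t ∉ D ∧ z ≠ y))
    (fun G h => not_hasPerfectMatching_of_isolated (x := y) fun z hz => by grind)
    ?_ ?_ ⟨her, htri, hin⟩ turn
  · rintro G ⟨her, htri, hin⟩ p hp q hq hpq
    refine ⟨her.mono (le_addEdge _ _),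
      fun z t h1 h2 h3 h4 h5 => le_addEdge _ _ (htri z t h1 h2 h3 h4 h5), fun z t => ?_⟩
    rw [addEdge_adj]
    grind
  clear her htri hin
  rintro G ⟨her, htri, hin⟩ p q hp hpq hnadj hPM
  right
  have hspan : ∀ z, z ∉ D → z ≠ y → ∃ r s, IsComplQuad D z r s y := by
    unfold IsComplQuad at *
    intro z hz hzy
    obtain rfl | rfl | rfl : z = a ∨ z = b ∨ z = c := by grind
    · exact ⟨b, c, by grind⟩
    · exact ⟨a, c, by grind⟩
    · exact ⟨a, b, by grind⟩
  by_cases hq : q ∈ D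
  · obtain ⟨q', hq', hqq', hv⟩ := her.2 q hq
    by_cases hpy : p = y
    · subst hpy
      have hle : G ≤ addEdge (addEdge G s(p, q)) s(p, q') :=
        (le_addEdge _ _).trans (le_addEdge _ _)
      unfold IsComplQuad at hc
      have hPM' : ¬ hasPerfectMatching (addEdge (addEdge G s(p, q)) s(p, q')) := by
        refine not_hasPerfectMatching_of_triple (a := a) (b := b) (c := c) (fun z t => ?_)
          (by grind) (by grind) (by grind)
        have h₁ := hin z t
        have h₂ := hin t z
        have h₃ := G.adj_comm z t
        clear hspan
        rw [addEdge_adj, addEdge_adj]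
        grind
      refine maxEnsures_true_of_add (a := p) (b := q') (by grind) hPM' fun turn => ?_
      refine maxEnsures_of_factorCritical_edge (D := insert p D) (u := a) (v := b) (w := c) ?_
        (by unfold IsComplTriple; grind) ?_ (hle (htri a b ?_ ?_ ?_ ?_ ?_)) hPM' turn
      · rw [Finset.card_insert_of_notMem hp]
        omega
      · refine factorCriticalOn_insert (w := q) (w' := q') (her.1.mono hle)
          (fun v hvD => ?_) hq hq' hp (addEdge_adj.2 ?_) (addEdge_adj.2 ?_)
        · exact (hv v hvD).imp (fun h => ⟨h.1, h.2.mono hle⟩) (fun h => ⟨h.1, h.2.mono hle⟩)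
        · exact Or.inl (addEdge_adj.2 (by grind))
        · grind
      all_goals grind
    · obtain ⟨r, s, hprs⟩ := hspan p hp hpy
      unfold IsComplQuad at hprs
      have hle : G ≤ addEdge (addEdge G s(p, q)) s(r, q') :=
        (le_addEdge _ _).trans (le_addEdge _ _)
      have hiso : ∀ z, ¬ (addEdge (addEdge G s(p, q)) s(r, q')).Adj y z := by
        intro z
        rw [addEdge_adj, addEdge_adj]
        grind
      refine maxEnsures_true_of_add (a := r) (b := q') (by grind)
        (not_hasPerfectMatching_of_isolated hiso) fun turn => ?_
      refine maxEnsures_of_factorCritical_isolated (D := insert p (insert r (insert s D)))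
        (x := y) ?_ (by grind) (by grind) ?_ hiso turn
      · have : D.card ≤ (insert p (insert r (insert s D))).card :=
          Finset.card_le_card (by grind)
        omega
      · refine factorCriticalOn_insert_triangle (w := q) (w' := q') (her.1.mono hle)
          (fun v hvD => ?_) hq hq' hp (by grind) (by grind) (hle (htri _ _ ?_ ?_ ?_ ?_ ?_))
          (hle (htri _ _ ?_ ?_ ?_ ?_ ?_)) (hle (htri _ _ ?_ ?_ ?_ ?_ ?_))
          (addEdge_adj.2 (Or.inl (addEdge_adj.2 ?_))) (addEdge_adj.2 ?_)
        · exact (hv v hvD).imp (fun h => ⟨h.1, h.2.mono hle⟩) (fun h => ⟨h.1, h.2.mono hle⟩)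
        all_goals grind
  · exfalso
    have key : ∀ z, z ∉ D → z ≠ y → ¬ (addEdge G s(p, q)).Adj z y := by
      intro z hz hzy hadj
      obtain ⟨r, s, hc'⟩ := hspan z hz hzy
      unfold IsComplQuad at hc'
      refine hPM (((((her.1.mono (le_addEdge _ _)).insert_insert (a := r) (b := s)
        (le_addEdge _ _ (htri _ _ ?_ ?_ ?_ ?_ ?_)) ?_ ?_).insert_insert hadj
        ?_ ?_)).hasPerfectMatching ?_)
      all_goals grind
    by_cases hpy : p = y
    · exact key q hq (by grind) (addEdge_adj.2 (by grind))
    · by_cases hqy : q = y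
      · exact key p hp hpy (addEdge_adj.2 (by grind))
      · exact hnadj (htri p q hp hq hpy hqy hpq)

theorem maxEnsures_of_earReady_edge {u v x y : V} (hD : Fintype.card V ≤ D.card + 4)
    (hc : IsComplQuad D u v x y) (her : EarReadyOn G D) (huv : G.Adj u v)
    (hin : ∀ z t, G.Adj z t → (z ∈ D ∧ t ∈ D) ∨ z = u ∧ t = v ∨ z = v ∧ t = u) (turn : Bool) :
    MaxEnsures turn G := by
  refine maxEnsures_of_filling hD
    (fun G => EarReadyOn G D ∧ G.Adj u v ∧
      ∀ z t, G.Adj z t → (z ∈ D ∧ t ∈ D) ∨ z = u ∧ t = v ∨ z = v ∧ t = u)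
    (fun G h => not_hasPerfectMatching_of_isolated (x := y) fun z hz => by
      unfold IsComplQuad at hc
      grind)
    ?_ ?_ ⟨her, huv, hin⟩ turn
  · rintro G ⟨her, huv, hin⟩ p hp q hq hpq
    refine ⟨her.mono (le_addEdge _ _), le_addEdge _ _ huv, fun z t => ?_⟩
    rw [addEdge_adj]
    grind
  clear her huv hin
  rintro G ⟨her, huv, hin⟩ p q hp hpq hnadj hPM
  right
  by_cases hq : q ∈ D
  · obtain ⟨q', hq', hqq', hv⟩ := her.2 q hq
    have hv' : ∀ {H}, G ≤ H → ∀ v ∈ D, (v ≠ q ∧ MatchableOn H ((D.erase v).erase q)) ∨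
        (v ≠ q' ∧ MatchableOn H ((D.erase v).erase q')) := fun hle v hvD =>
      (hv v hvD).imp (fun h => ⟨h.1, h.2.mono hle⟩) (fun h => ⟨h.1, h.2.mono hle⟩)
    by_cases hpuv : p = u ∨ p = v
    · obtain ⟨r, hprc, hpr⟩ : ∃ r, IsComplQuad D p r x y ∧ G.Adj p r := by
        unfold IsComplQuad at *
        rcases hpuv with rfl | rfl
        · exact ⟨v, hc, huv⟩
        · exact ⟨u, by grind, huv.symm⟩
      unfold IsComplQuad at hc hprc
      have hle : G ≤ addEdge (addEdge G s(p, q)) s(r, q') :=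
        (le_addEdge _ _).trans (le_addEdge _ _)
      have hin' : ∀ z t, (addEdge (addEdge G s(p, q)) s(r, q')).Adj z t →
          z ∈ insert p (insert r D) := by
        intro z t
        rw [addEdge_adj, addEdge_adj]
        grind
      refine maxEnsures_true_of_add (a := r) (b := q') (by grind)
        (not_hasPerfectMatching_of_isolated (x := x) fun z hz => by
          have := hin' _ _ hz
          grind) fun turn => ?_
      refine maxEnsures_of_earReady_two (D := insert p (insert r D)) (x := x) (y := y) ?_
        (by grind) (by grind) (by grind) (by grind) ?_ hin' turn
      · have : D.card ≤ (insert p (insert r D)).card := Finset.card_le_card (by grind)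
        omega
      · exact (her.mono hle).insert_path (hv' hle) hq hq' hp (by grind) (hle hpr)
          (addEdge_adj.2 (Or.inl (addEdge_adj.2 (by grind)))) (addEdge_adj.2 (by grind))
    · obtain ⟨r, hprc⟩ : ∃ r, IsComplQuad D u v p r := by
        unfold IsComplQuad at *
        obtain rfl | rfl : p = x ∨ p = y := by grind
        · exact ⟨y, hc⟩
        · exact ⟨x, by grind⟩
      unfold IsComplQuad at hc hprc
      have hle : G ≤ addEdge (addEdge G s(p, q)) s(p, q') :=
        (le_addEdge _ _).trans (le_addEdge _ _)
      have hPM' : ¬ hasPerfectMatching (addEdge (addEdge G s(p, q)) s(p, q')) := by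
        refine not_hasPerfectMatching_of_isolated (x := r) fun z => ?_
        rw [addEdge_adj, addEdge_adj]
        grind
      refine maxEnsures_true_of_add (a := p) (b := q') (by grind) hPM' fun turn => ?_
      refine maxEnsures_of_factorCritical_edge (D := insert p D) (u := u) (v := v) (w := r) ?_
        (by unfold IsComplTriple; grind) ?_ (hle huv) hPM' turn
      · rw [Finset.card_insert_of_notMem hp]
        omega
      · exact factorCriticalOn_insert (w := q) (w' := q') (her.1.mono hle) (hv' hle) hq hq' hp
          (addEdge_adj.2 (Or.inl (addEdge_adj.2 (by grind)))) (addEdge_adj.2 (by grind))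
  · have key : ∀ p' q' r s, IsComplQuad D p' r q' s → G.Adj p' r →
        (p' = u ∧ r = v ∨ p' = v ∧ r = u) →
        (p = p' ∧ q = q' ∨ p = q' ∧ q = p') → MaxEnsures true (addEdge G s(p, q)) := by
      intro p' q' r s hc' hadj hpr hpq'
      have hc'' := hc'
      unfold IsComplQuad at hc hc'
      have hle : G ≤ addEdge (addEdge G s(p, q)) s(r, q') :=
        (le_addEdge _ _).trans (le_addEdge _ _)
      have hin' : ∀ z t, (addEdge (addEdge G s(p, q)) s(r, q')).Adj z t →
          (z ∈ D ∧ t ∈ D) ∨ (z ∉ D ∧ t ∉ D ∧ z ≠ s) := by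
        intro z t
        rw [addEdge_adj, addEdge_adj]
        grind
      refine maxEnsures_true_of_add (a := r) (b := q') (by grind)
        (not_hasPerfectMatching_of_isolated (x := s) fun z hz => by
          have := hin' _ _ hz
          grind) fun turn => ?_
      refine maxEnsures_of_earReady_triangle hD hc'' (her.mono hle) (fun z t h1 h2 h3 h4 h5 => ?_)
        hin' turn
      have := hadj.symm
      rw [addEdge_adj, addEdge_adj]
      grind
    have hvu := huv.symm
    have hc₀ := hc
    unfold IsComplQuad at hc
    have hnot : ¬ ((p = x ∧ q = y) ∨ (p = y ∧ q = x)) := by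
      intro h
      refine hPM (((her.1.mono (le_addEdge _ _)).insert_insert (le_addEdge _ _ huv) ?_
        ?_).insert_insert (a := p) (b := q) (addEdge_adj.2 ?_) ?_ ?_ |>.hasPerfectMatching ?_)
      all_goals grind
    obtain h | h | h | h : (p = u ∧ q = x ∨ p = x ∧ q = u) ∨ (p = u ∧ q = y ∨ p = y ∧ q = u) ∨
        (p = v ∧ q = x ∨ p = x ∧ q = v) ∨ (p = v ∧ q = y ∨ p = y ∧ q = v) := by
      have h1 := hc.1 p
      have h2 := hc.1 q
      grind
    · exact key u x v y hc₀ huv (by simp) h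
    · exact key u y v x (by unfold IsComplQuad; grind) huv (by simp) h
    · exact key v x u y (by unfold IsComplQuad; grind) hvu (by simp) h
    · exact key v y u x (by unfold IsComplQuad; grind) hvu (by simp) h

omit [Fintype V] [DecidableEq V] in
/-- A vertex `u` joined to some vertex `d` of a path can be absorbed by adding one more edge. -/
theorem exists_absorbing_edge {l : List V} {d u : V} (hnd : l.Nodup) (hch : l.IsChain G.Adj)
    (hlen : 2 ≤ l.length) (hd : d ∈ l) (hu : u ∉ l) :
    ∃ c ∈ l, c ≠ d ∧ ∃ l' : List V, l'.Perm (u :: l) ∧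
      l'.IsChain (addEdge (addEdge G s(u, d)) s(u, c)).Adj := by
  obtain ⟨s, t, rfl⟩ := List.append_of_mem hd
  have hle : ∀ c, G ≤ addEdge (addEdge G s(u, d)) s(u, c) := fun c =>
    (le_addEdge _ _).trans (le_addEdge _ _)
  have hud : u ≠ d := fun h => hu (h ▸ hd)
  rcases s with _ | ⟨c, s⟩
  · obtain ⟨c, hc⟩ : ∃ c, c ∈ t := List.exists_mem_of_ne_nil t (by rintro rfl; simp at hlen)
    refine ⟨c, by simp [hc], by grind, u :: d :: t, by simp, ?_⟩
    refine List.isChain_cons_cons.2 ⟨le_addEdge _ _ (addEdge_adj.2 (by grind)), ?_⟩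
    exact isChain_adj_mono (hle c) (by simpa using hch)
  · refine ⟨c, by simp, by grind, (c :: s).reverse ++ u :: d :: t, ?_, ?_⟩
    · refine ((List.reverse_perm _).append_right _).trans ?_
      exact List.perm_middle
    · rw [List.isChain_append] at hch ⊢
      refine ⟨?_, ?_, ?_⟩
      · rw [List.isChain_reverse]
        exact (isChain_adj_mono (hle c) hch.1).imp fun _ _ h => h.symm
      · refine List.isChain_cons_cons.2 ⟨le_addEdge _ _ (addEdge_adj.2 (by grind)), ?_⟩
        exact isChain_adj_mono (hle c) hch.2.1
      · intro x hx y hy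
        simp at hx hy
        subst hx hy
        rw [addEdge_adj]
        grind

theorem List.exists_notMem_of_length_lt {l : List V} (h : l.length < Fintype.card V) :
    ∃ x, x ∉ l := by
  by_contra! hall
  have h1 := List.toFinset_card_le l
  rw [Finset.eq_univ_of_forall fun x => List.mem_toFinset.2 (hall x), Finset.card_univ] at h1
  omega

theorem exists_isComplTriple {a b : V} (hD : D.card + 3 = Fintype.card V) (ha : a ∉ D)
    (hb : b ∉ D) (hab : a ≠ b) : ∃ w, IsComplTriple D a b w := by
  have h : ((Dᶜ.erase a).erase b).card = 1 := by
    rw [Finset.card_erase_of_mem (by simp [hb, hab.symm]), Finset.card_erase_of_mem (by simpa),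
      Finset.card_compl]
    omega
  obtain ⟨w, hw⟩ := Finset.card_eq_one.1 h
  refine ⟨w, ?_⟩
  have key : ∀ z, (z ∉ D ∧ z ≠ a ∧ z ≠ b) ↔ z = w := fun z => by
    have := Finset.ext_iff.1 hw z
    simp at this
    grind
  have := (key w).2 rfl
  unfold IsComplTriple
  grind

theorem exists_isComplQuad {a b : V} (hD : D.card + 4 = Fintype.card V) (ha : a ∉ D)
    (hb : b ∉ D) (hab : a ≠ b) : ∃ x y, IsComplQuad D a b x y := by
  have h : ((Dᶜ.erase a).erase b).card = 2 := by
    rw [Finset.card_erase_of_mem (by simp [hb, hab.symm]), Finset.card_erase_of_mem (by simpa),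
      Finset.card_compl]
    omega
  obtain ⟨x, y, hxy, hw⟩ := Finset.card_eq_two.1 h
  refine ⟨x, y, ?_⟩
  have key : ∀ z, (z ∉ D ∧ z ≠ a ∧ z ≠ b) ↔ z = x ∨ z = y := fun z => by
    have := Finset.ext_iff.1 hw z
    simp at this
    grind
  have h1 := (key x).2 (by simp)
  have h2 := (key y).2 (by simp)
  unfold IsComplQuad
  grind

/-- The position reached from a path on the vertices of `l` by one further edge `s(a, b)`, when
Max is to move and can handle longer paths. -/
theorem maxEnsures_of_path_add {l : List V} (heven : Even (Fintype.card V))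
    (hk : l.length + 3 ≤ Fintype.card V) (hlen : 2 ≤ l.length)
    (hnd : l.Nodup) (hch : l.IsChain G.Adj) (hin : ∀ a b, G.Adj a b → a ∈ l)
    (ih : ∀ (H : SimpleGraph V) (l' : List V), l.length < l'.length →
      l'.length + 3 ≤ Fintype.card V → l'.Nodup → l'.IsChain H.Adj →
      (∀ a b, H.Adj a b → a ∈ l') → MaxEnsures false H)
    {a b : V} (hab : a ≠ b) (hor : a ∈ l → b ∈ l) : MaxEnsures true (addEdge G s(a, b)) := by
  have move : ∀ (c d : V) (l' : List V), c ∉ l → d ∈ l → ¬ (c = a ∧ d = b) → (c ≠ b ∨ a ∉ l) →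
      l.length < l'.length → l'.length + 3 ≤ Fintype.card V → l'.Nodup →
      l'.IsChain (addEdge (addEdge G s(a, b)) s(c, d)).Adj →
      (∀ x ∈ l, x ∈ l') → a ∈ l' → b ∈ l' → c ∈ l' →
      MaxEnsures true (addEdge G s(a, b)) := by
    intro c d l' hc hd hcd hcb h1 h2 h3 h4 h5 ha hb hc'
    have hin' : ∀ x y, (addEdge (addEdge G s(a, b)) s(c, d)).Adj x y → x ∈ l' := by
      intro x y
      rw [addEdge_adj, addEdge_adj]
      have := hin x y
      clear h4 hch
      grind
    obtain ⟨x, hx⟩ := List.exists_notMem_of_length_lt (l := l') (by omega)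
    refine .protagonistMove _ s(c, d) (legalMove_mk.2 ⟨?_, ?_, ?_⟩) (ih _ l' h1 h2 h3 h4 hin')
    · rintro rfl
      exact hc hd
    · rw [addEdge_adj]
      have := hin c d
      clear h4 hch
      grind
    · exact not_hasPerfectMatching_of_isolated (x := x) fun y hy => hx (hin' _ _ hy)
  obtain ⟨h, t, rfl⟩ : ∃ h t, l = h :: t := List.exists_cons_of_length_pos (by omega)
  rw [List.length_cons] at hk hlen ih
  have htcard : (h :: t).toFinset.card = t.length + 1 := by
    rw [List.toFinset_card_of_nodup hnd, List.length_cons]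
  obtain ⟨z, hz⟩ : ∃ z, (h :: t).getLast? = some z := ⟨_, List.getLast?_eq_some_getLast (by simp)⟩
  have hzl : z ∈ h :: t := List.mem_of_getLast? hz
  have hzh : z ≠ h := by
    rintro rfl
    have : z ∈ t := by
      obtain ⟨y, t, rfl⟩ := List.exists_cons_of_length_pos (l := t) (by omega)
      rw [List.getLast?_cons_cons] at hz
      exact List.mem_of_getLast? hz
    exact (List.nodup_cons.1 hnd).1 this
  have hleG : G ≤ addEdge G s(a, b) := le_addEdge _ _
  have hleH : addEdge G s(a, b) ≤ addEdge (addEdge G s(a, b)) s(z, h) := le_addEdge _ _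
  have hcyc : ∀ x ∈ (h :: t).getLast?, ∀ y ∈ (h :: t).head?,
      (addEdge (addEdge G s(a, b)) s(z, h)).Adj x y := by
    intro x hx y hy
    obtain rfl : z = x := by simpa [hz] using hx
    obtain rfl : h = y := by simpa using hy
    rw [addEdge_adj]
    grind
  have hch' := isChain_adj_mono (hleG.trans hleH) hch
  have hmem : ∀ x, x ∈ (h :: t).toFinset ↔ x ∈ h :: t := fun x => List.mem_toFinset
  have hadj : ∀ x y, (addEdge (addEdge G s(a, b)) s(z, h)).Adj x y →
      (x ∈ h :: t ∧ y ∈ h :: t) ∨ x = a ∧ y = b ∨ x = b ∧ y = a := by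
    intro x y
    rw [addEdge_adj, addEdge_adj]
    have h₁ := hin x y
    have h₂ := hin y x
    have h₃ := G.adj_comm x y
    have h₄ : h ∈ h :: t := by simp
    clear hch hch' hcyc move ih
    grind
  have habadj : (addEdge (addEdge G s(a, b)) s(z, h)).Adj a b :=
    hleH (addEdge_adj.2 (by grind))
  generalize hHdef : addEdge (addEdge G s(a, b)) s(z, h) = H at hleH hcyc hch' hadj habadj
  have close : (∀ turn, MaxEnsures turn H) → ¬ hasPerfectMatching H →
      MaxEnsures true (addEdge G s(a, b)) := by
    subst hHdef
    exact fun h1 h2 => maxEnsures_true_of_add hzh h2 h1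
  by_cases hk3 : t.length + 4 = Fintype.card V
  · have hfc : FactorCriticalOn H (h :: t).toFinset :=
      factorCriticalOn_of_cycle hnd hch' hcyc (by
        rw [List.length_cons]
        grind)
    by_cases ha : a ∈ h :: t
    · have hb := hor ha
      obtain ⟨u, hu⟩ := List.exists_notMem_of_length_lt (l := h :: t) (by simp; omega)
      obtain ⟨v, hv⟩ := List.exists_notMem_of_length_lt (l := u :: h :: t) (by simp; omega)
      obtain ⟨w, hc⟩ := exists_isComplTriple (D := (h :: t).toFinset) (a := u) (b := v)
        (by omega) (by rwa [hmem]) (by rw [hmem]; grind) (by grind)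
      have hin' : ∀ x y, H.Adj x y → x ∈ (h :: t).toFinset := fun x y hxy => by
        rw [hmem]
        rcases hadj x y hxy with h | ⟨rfl, -⟩ | ⟨rfl, -⟩
        exacts [h.1, ha, hb]
      refine close (fun turn => maxEnsures_of_factorCritical_three (by omega) hc hfc hin' turn) ?_
      exact not_hasPerfectMatching_of_isolated (x := u) fun y hy => hu ((hmem u).1 (hin' _ _ hy))
    by_cases hb : b ∈ h :: t
    · obtain ⟨v, hv⟩ := List.exists_notMem_of_length_lt (l := a :: h :: t) (by simp; omega)
      obtain ⟨w, hc⟩ := exists_isComplTriple (D := (h :: t).toFinset) (a := a) (b := v)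
        (by omega) (by rwa [hmem]) (by rw [hmem]; grind) (by grind)
      have hin' : ∀ x y, H.Adj x y → x ∈ insert a (h :: t).toFinset := fun x y hxy => by
        rw [Finset.mem_insert, hmem]
        rcases hadj x y hxy with h | ⟨rfl, -⟩ | ⟨rfl, -⟩
        exacts [Or.inr h.1, Or.inl rfl, Or.inr hb]
      unfold IsComplTriple at hc
      have hvD : v ∉ insert a (h :: t).toFinset := by grind
      refine close (fun turn => maxEnsures_of_earReady_two (D := insert a (h :: t).toFinset)
        (x := v) (y := w) ?_ (by grind) hvD (by grind) (by grind) ?_ hin' turn) ?_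
      · rw [Finset.card_insert_of_notMem hc.2.1]
        omega
      · exact hfc.earReadyOn_insert ((hmem b).2 hb) hc.2.1 habadj
      · exact not_hasPerfectMatching_of_isolated (x := v) fun y hy => hvD (hin' _ _ hy)
    · obtain ⟨w, hc⟩ := exists_isComplTriple (D := (h :: t).toFinset) (a := a) (b := b)
        (by omega) (by rwa [hmem]) (by rwa [hmem]) hab
      have hiso : ∀ y, ¬ H.Adj w y := fun y hy => by
        have := hadj w y hy
        have := hmem w
        unfold IsComplTriple at hc
        grind
      have hPM := not_hasPerfectMatching_of_isolated hiso
      exact close (fun turn => maxEnsures_of_factorCritical_edge (by omega) hc hfc habadj hPM turn)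
        hPM
  by_cases ha : a ∈ h :: t
  · have hb := hor ha
    obtain ⟨x, hx⟩ := List.exists_notMem_of_length_lt (l := h :: t) (by simp; omega)
    refine move x h (x :: h :: t) hx (by simp) (by grind) (by grind) (by simp)
      (by simp; omega) (List.nodup_cons.2 ⟨hx, hnd⟩) ?_ (by grind) (by grind) (by grind) (by simp)
    refine List.isChain_cons_cons.2 ⟨addEdge_adj.2 (by grind), ?_⟩
    exact isChain_adj_mono (hleG.trans (le_addEdge _ _)) hch
  by_cases hb : b ∈ h :: t
  · obtain ⟨c, hc, hcb, l', hp, hl'⟩ := exists_absorbing_edge hnd hch (by simpa using hlen) hb ha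
    refine move a c l' ha hc (by grind) (by grind) (by simp [hp.length_eq])
      (by simp [hp.length_eq]; omega) (hp.nodup_iff.2 (List.nodup_cons.2 ⟨ha, hnd⟩)) hl' ?_ ?_ ?_ ?_
    all_goals simp only [hp.mem_iff]; grind
  · by_cases hk4 : t.length + 5 = Fintype.card V
    · have her : EarReadyOn H (h :: t).toFinset :=
        earReadyOn_of_cycle hnd hch' hcyc (by
          rw [List.length_cons]
          grind)
      obtain ⟨x, y, hc⟩ := exists_isComplQuad (D := (h :: t).toFinset) (a := a) (b := b)
        (by omega) (by rwa [hmem]) (by rwa [hmem]) hab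
      have hin' : ∀ z t', H.Adj z t' → (z ∈ (h :: t).toFinset ∧ t' ∈ (h :: t).toFinset) ∨
          z = a ∧ t' = b ∨ z = b ∧ t' = a := by
        simpa only [hmem] using hadj
      refine close (fun turn => maxEnsures_of_earReady_edge (by omega) hc her habadj hin' turn) ?_
      refine not_hasPerfectMatching_of_isolated (x := x) fun z hz => ?_
      have := hin' x z hz
      unfold IsComplQuad at hc
      grind
    · refine move b h (a :: b :: h :: t) hb (by simp) (by grind) (by grind) (by simp)
        (by simp; omega) (by grind) ?_ (by grind) (by grind) (by grind) (by simp)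
      refine List.isChain_cons_cons.2 ⟨le_addEdge _ _ (addEdge_adj.2 (by grind)), ?_⟩
      refine List.isChain_cons_cons.2 ⟨addEdge_adj.2 (by grind), ?_⟩
      exact isChain_adj_mono (hleG.trans (le_addEdge _ _)) hch

theorem maxEnsures_of_path {l : List V} (heven : Even (Fintype.card V))
    (hk : l.length + 3 ≤ Fintype.card V) (hlen : 2 ≤ l.length)
    (hnd : l.Nodup) (hch : l.IsChain G.Adj) (hin : ∀ a b, G.Adj a b → a ∈ l) :
    MaxEnsures false G := by
  induction hm : Fintype.card V - l.length using Nat.strong_induction_on generalizing G l with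
  | _ m ih =>
    subst hm
    obtain ⟨u, hu⟩ := List.exists_notMem_of_length_lt (l := l) (by omega)
    obtain ⟨v, hv⟩ := List.exists_notMem_of_length_lt (l := u :: l) (by simp; omega)
    obtain ⟨w, hw⟩ := List.exists_notMem_of_length_lt (l := v :: u :: l) (by simp; omega)
    have ih' : ∀ (H : SimpleGraph V) (l' : List V), l.length < l'.length →
        l'.length + 3 ≤ Fintype.card V → l'.Nodup → l'.IsChain H.Adj →
        (∀ a b, H.Adj a b → a ∈ l') → MaxEnsures false H := fun H l' h1 h2 h3 h4 h5 =>
      ih _ (by omega) h2 (by omega) h3 h4 h5 rfl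
    refine .opponentMove G s(u, v) (legalMove_mk.2 ⟨by grind, fun h => hu (hin _ _ h), ?_⟩)
      fun e he => ?_
    · refine not_hasPerfectMatching_of_isolated (x := w) fun y => ?_
      rw [addEdge_adj]
      have := hin w y
      clear hch
      grind
    · induction e with | _ a b
      have hab := (legalMove_mk.1 he).1
      by_cases hor : a ∈ l → b ∈ l
      · exact maxEnsures_of_path_add heven hk hlen hnd hch hin ih' hab hor
      · rw [Sym2.eq_swap]
        exact maxEnsures_of_path_add heven hk hlen hnd hch hin ih' hab.symm (by tauto)

end Game

/-- In the saturation game `(n, PM)` with `n ≥ 8` even, Max (moving first or second) can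
guarantee a final score of at least `C(n-4, 2)`. -/
theorem statement_4 (n : ℕ) (hn : 8 ≤ n) (hne : Even n) :
    ∀ turn : Bool,
      GameEnsures hasPerfectMatching
        (fun G : SimpleGraph (Fin n) => (n - 4).choose 2 ≤ G.edgeSet.ncard)
        turn ⊥ := by
  have hcard : Fintype.card (Fin n) = n := Fintype.card_fin n
  suffices h : ∀ turn, MaxEnsures turn (⊥ : SimpleGraph (Fin n)) by
    simpa only [MaxEnsures, hcard] using h
  have legal : ∀ (G : SimpleGraph (Fin n)) (a b : Fin n) (l : List (Fin n)), a ≠ b →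
      ¬ G.Adj a b → l.length < n → (∀ x y, (addEdge G s(a, b)).Adj x y → x ∈ l) →
      legalMove hasPerfectMatching G s(a, b) := by
    intro G a b l hab hadj hl hin
    obtain ⟨z, hz⟩ := List.exists_notMem_of_length_lt (l := l) (by omega)
    exact legalMove_mk.2 ⟨hab, hadj, not_hasPerfectMatching_of_isolated fun y hy => hz (hin _ _ hy)⟩
  have hin : ∀ a b x y : Fin n, (addEdge ⊥ s(a, b)).Adj x y → x ∈ [a, b] := by
    intro a b x y
    rw [addEdge_adj]
    simp
    grind
  obtain ⟨u, hu⟩ := List.exists_notMem_of_length_lt (V := Fin n) (l := []) (by simp; omega)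
  obtain ⟨v, hv⟩ := List.exists_notMem_of_length_lt (V := Fin n) (l := [u]) (by simp; omega)
  have huv : u ≠ v := by grind
  have hleg := legal ⊥ u v [u, v] huv (by simp) (by simp; omega) (hin u v)
  rintro (_ | _)
  · refine .opponentMove _ _ hleg fun e he => ?_
    induction e with | _ a b
    have hab := (legalMove_mk.1 he).1
    obtain ⟨x, hx⟩ := List.exists_notMem_of_length_lt (V := Fin n) (l := [a, b]) (by simp; omega)
    have hxadj : ¬ (addEdge ⊥ s(a, b)).Adj x a := fun h => hx (hin _ _ _ _ h)
    have hin' : ∀ p q : Fin n, (addEdge (addEdge ⊥ s(a, b)) s(x, a)).Adj p q → p ∈ [x, a, b] := by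
      intro p q
      have := hin a b p q
      rw [addEdge_adj]
      grind
    refine .protagonistMove _ s(x, a) (legal _ x a _ (by grind) hxadj (by simp; omega) hin') ?_
    refine maxEnsures_of_path (l := [x, a, b]) (by rwa [hcard]) (by simp; omega)
      (by simp) (by grind) ?_ hin'
    refine List.isChain_cons_cons.2 ⟨addEdge_adj.2 (by grind), List.isChain_pair.2 ?_⟩
    exact le_addEdge _ _ (addEdge_adj.2 (by grind))
  · refine .protagonistMove _ _ hleg ?_
    exact maxEnsures_of_path (l := [u, v]) (by rwa [hcard]) (by simp; omega)
      (by simp) (by grind) (List.isChain_pair.2 (addEdge_adj.2 (by grind))) (hin u v)
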